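/- In the priority evacuation model with 3 servants, there exist trajectories Q, S₁, S₂, S₃ that evacuate the queen in time 3.37882. -/

import Mathlib

open Real Set MeasureTheory
open scoped RealInnerProductSpace

noncomputable section

abbrev Plane : Type := EuclideanSpace ℝ (Fin 2)

/-- The point of the unit circle at angle `θ`. -/
def circlePt (θ : ℝ) : Plane := (WithLp.equiv 2 (Fin 2 → ℝ)).symm ![Real.cos θ, Real.sin θ]

/-- A trajectory in the priority evacuation model: a `1`-Lipschitz function on `[0, ∞)`
starting at the origin. -/
def IsTraj (f : ℝ → Plane) : Prop :=
  LipschitzOnWith 1 f (Set.Ici 0) ∧ f 0 = 0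

/-- The first-visit time of the point `p` by the queen `Q` or one of the servants `S i`. -/
def visitTime {n : ℕ} (Q : ℝ → Plane) (S : Fin n → ℝ → Plane) (p : Plane) : ℝ :=
  sInf {t : ℝ | 0 ≤ t ∧ (Q t = p ∨ ∃ i, S i t = p)}

/-- The trajectories `Q` (queen) and `S 0, …, S (n-1)` (servants) evacuate the queen in
time `B`: every point of the unit circle is visited, and the first-visit time plus the
distance from the queen (at that moment) to the point is at most `B`. -/
def Evacuates {n : ℕ} (Q : ℝ → Plane) (S : Fin n → ℝ → Plane) (B : ℝ) : Prop :=
  ∀ p : Plane, ‖p‖ = 1 →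
    (∃ t : ℝ, 0 ≤ t ∧ (Q t = p ∨ ∃ i, S i t = p)) ∧
    visitTime Q S p + ‖Q (visitTime Q S p) - p‖ ≤ B

/-- The set of angles in `[0, 2π)` whose circle point is visited by the queen at some
time in `Tset`; its Lebesgue measure is the arc measure of the queen-explored set. -/
def queenArc (Q : ℝ → Plane) (Tset : Set ℝ) : Set ℝ :=
  {θ : ℝ | θ ∈ Set.Ico 0 (2 * π) ∧ ∃ s ∈ Tset, Q s = circlePt θ}

lemma circlePt_zero_coord (θ : ℝ) : circlePt θ 0 = Real.cos θ := rfl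

lemma circlePt_one_coord (θ : ℝ) : circlePt θ 1 = Real.sin θ := rfl

lemma Plane.norm_sq (p : Plane) : ‖p‖ ^ 2 = p 0 ^ 2 + p 1 ^ 2 := by
  simp [EuclideanSpace.norm_sq_eq, Fin.sum_univ_two]

lemma Plane.norm_le_of_sq_le {p : Plane} {r : ℝ} (hr : 0 ≤ r) (h : p 0 ^ 2 + p 1 ^ 2 ≤ r ^ 2) :
    ‖p‖ ≤ r :=
  abs_le_of_sq_le_sq' (by rwa [Plane.norm_sq]) hr |>.2

lemma Plane.mul_add_mul_le_norm (p : Plane) {u w : ℝ} (h : u ^ 2 + w ^ 2 ≤ 1) :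
    u * p 0 + w * p 1 ≤ ‖p‖ := by
  refine abs_le_of_sq_le_sq' ?_ (norm_nonneg p) |>.2
  rw [Plane.norm_sq]
  nlinarith [sq_nonneg (u * p 1 - w * p 0), sq_nonneg (p 0), sq_nonneg (p 1)]

lemma Plane.exists_mul_add_mul_eq_norm (p : Plane) :
    ∃ u w : ℝ, u ^ 2 + w ^ 2 ≤ 1 ∧ u * p 0 + w * p 1 = ‖p‖ := by
  rcases eq_or_ne ‖p‖ 0 with h | h
  · exact ⟨0, 0, by norm_num, by simp [h]⟩
  · refine ⟨p 0 / ‖p‖, p 1 / ‖p‖, ?_, ?_⟩ <;> field_simp <;> rw [Plane.norm_sq]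

lemma norm_circlePt (θ : ℝ) : ‖circlePt θ‖ = 1 := by
  have h := Plane.norm_sq (circlePt θ)
  rw [circlePt_zero_coord, circlePt_one_coord, Real.cos_sq_add_sin_sq] at h
  nlinarith [norm_nonneg (circlePt θ)]

lemma norm_circlePt_sub_le (a b : ℝ) : ‖circlePt a - circlePt b‖ ≤ |a - b| := by
  refine Plane.norm_le_of_sq_le (abs_nonneg _) ?_
  simp only [PiLp.sub_apply, circlePt_zero_coord, circlePt_one_coord, sq_abs]
  have h := Real.one_sub_sq_div_two_le_cos (x := a - b)
  rw [Real.cos_sub] at h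
  nlinarith [Real.cos_sq_add_sin_sq a, Real.cos_sq_add_sin_sq b]

lemma exists_circlePt_eq {p : Plane} (hp : ‖p‖ = 1) :
    ∃ θ ∈ Set.Icc 0 (2 * π), circlePt θ = p := by
  have h := Plane.norm_sq p
  rw [hp] at h
  have hz : ‖(⟨p 0, p 1⟩ : ℂ)‖ = 1 := by
    rw [Complex.norm_eq_sqrt_sq_add_sq, ← h]; simp
  have hz0 : (⟨p 0, p 1⟩ : ℂ) ≠ 0 := by
    intro h0; rw [h0] at hz; simp at hz
  have hc : Real.cos (Complex.arg ⟨p 0, p 1⟩) = p 0 := by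
    rw [Complex.cos_arg hz0, hz]; simp
  have hs : Real.sin (Complex.arg ⟨p 0, p 1⟩) = p 1 := by
    rw [Complex.sin_arg, hz]; simp
  have h1 := Complex.neg_pi_lt_arg ⟨p 0, p 1⟩
  have h2 := Complex.arg_le_pi ⟨p 0, p 1⟩
  rcases le_total 0 (Complex.arg ⟨p 0, p 1⟩) with h0 | h0
  · refine ⟨_, ⟨h0, by linarith⟩, ?_⟩
    ext i; fin_cases i
    · exact hc
    · exact hs
  · refine ⟨Complex.arg ⟨p 0, p 1⟩ + 2 * π, ⟨by linarith, by linarith⟩, ?_⟩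
    ext i; fin_cases i
    · exact (Real.cos_add_two_pi _).trans hc
    · exact (Real.sin_add_two_pi _).trans hs

lemma convexOn_sq_div_two_sub_trig {u w : ℝ} (h : u ^ 2 + w ^ 2 ≤ 1) (β σ A C : ℝ)
    (hσ : σ ^ 2 = 1) :
    ConvexOn ℝ Set.univ (fun s : ℝ =>
      s ^ 2 / 2 + A * s + C - (u * Real.cos (β + σ * s) + w * Real.sin (β + σ * s))) := by
  have hd : ∀ s : ℝ, HasDerivAt (fun s : ℝ =>
      s ^ 2 / 2 + A * s + C - (u * Real.cos (β + σ * s) + w * Real.sin (β + σ * s)))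
      (s + A - (u * (-Real.sin (β + σ * s) * σ) + w * (Real.cos (β + σ * s) * σ))) s := by
    intro s
    have hl : HasDerivAt (fun s : ℝ => β + σ * s) σ s := by
      simpa using ((hasDerivAt_id s).const_mul σ).const_add β
    have hq : HasDerivAt (fun s : ℝ => s ^ 2 / 2 + A * s + C) (s + A) s := by
      have := ((((hasDerivAt_id s).pow 2).div_const 2).add
        ((hasDerivAt_id s).const_mul A)).add_const C
      refine this.congr_deriv ?_
      simp
    exact hq.sub ((hl.cos.const_mul u).add (hl.sin.const_mul w))
  have hd2 : ∀ s : ℝ, HasDerivAt (fun s : ℝ =>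
      s + A - (u * (-Real.sin (β + σ * s) * σ) + w * (Real.cos (β + σ * s) * σ)))
      (1 - (u * (-(Real.cos (β + σ * s) * σ) * σ) + w * (-Real.sin (β + σ * s) * σ * σ))) s := by
    intro s
    have hl : HasDerivAt (fun s : ℝ => β + σ * s) σ s := by
      simpa using ((hasDerivAt_id s).const_mul σ).const_add β
    exact ((hasDerivAt_id s).add_const A).sub
      (((hl.sin.neg.mul_const σ).const_mul u).add ((hl.cos.mul_const σ).const_mul w))
  refine MonotoneOn.convexOn_of_deriv convex_univ
    (fun s _ => (hd s).continuousAt.continuousWithinAt)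
    (fun s _ => (hd s).differentiableAt.differentiableWithinAt) ?_
  rw [interior_univ, monotoneOn_univ, funext fun s => (hd s).deriv]
  refine monotone_of_deriv_nonneg (fun s => (hd2 s).differentiableAt) fun s => ?_
  rw [(hd2 s).deriv]
  have hb : (-u * Real.cos (β + σ * s) + -w * Real.sin (β + σ * s)) ≤ 1 := by
    have := Plane.mul_add_mul_le_norm (circlePt (β + σ * s)) (u := -u) (w := -w) (by simpa using h)
    rwa [norm_circlePt] at this
  linear_combination hb - (u * Real.cos (β + σ * s) + w * Real.sin (β + σ * s)) * hσ

/-- While a queen moves along a line and a servant along the unit circle, the evacuation time on a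
short time interval exceeds its values at the ends by at most an eighth of the squared length. -/
lemma add_norm_line_sub_circlePt_le_of_ends {P v : Plane} {a β σ B s₀ s₁ s : ℝ} (hσ : σ ^ 2 = 1)
    (h₀ : a + s₀ + ‖P + s₀ • v - circlePt (β + σ * s₀)‖ ≤ B - (s₁ - s₀) ^ 2 / 8)
    (h₁ : a + s₁ + ‖P + s₁ • v - circlePt (β + σ * s₁)‖ ≤ B - (s₁ - s₀) ^ 2 / 8)
    (hs : s ∈ Set.Icc s₀ s₁) :
    a + s + ‖P + s • v - circlePt (β + σ * s)‖ ≤ B := by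
  obtain ⟨u, w, huw, hn⟩ :=
    Plane.exists_mul_add_mul_eq_norm (P + s • v - circlePt (β + σ * s))
  have hc := convexOn_sq_div_two_sub_trig huw β σ
    (1 + u * v 0 + w * v 1 - (s₀ + s₁) / 2) (a + u * P 0 + w * P 1 + ((s₀ + s₁) / 2) ^ 2 / 2) hσ
  have hm := hc.le_max_of_mem_Icc (Set.mem_univ s₀) (Set.mem_univ s₁) hs
  have e₀ := Plane.mul_add_mul_le_norm (P + s₀ • v - circlePt (β + σ * s₀)) huw
  have e₁ := Plane.mul_add_mul_le_norm (P + s₁ • v - circlePt (β + σ * s₁)) huw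
  rw [← hn]
  simp only [PiLp.sub_apply, PiLp.add_apply, PiLp.smul_apply, smul_eq_mul, circlePt_zero_coord,
    circlePt_one_coord] at e₀ e₁ ⊢
  rcases le_max_iff.1 hm with hm | hm
  · linarith [sq_nonneg (s - (s₀ + s₁) / 2)]
  · linarith [sq_nonneg (s - (s₀ + s₁) / 2)]

lemma add_norm_line_sub_circlePt_le_of_grid {P v : Plane} {a β σ B h : ℝ} (hσ : σ ^ 2 = 1)
    (N : ℕ)
    (H : ∀ k : ℕ, k ≤ N →
      a + k * h + ‖P + (k * h) • v - circlePt (β + σ * (k * h))‖ ≤ B - h ^ 2 / 8)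
    {s : ℝ} (hs₀ : 0 ≤ s) (hs : s ≤ N * h) :
    a + s + ‖P + s • v - circlePt (β + σ * s)‖ ≤ B := by
  induction N with
  | zero =>
    have h0 := H 0 le_rfl
    simp only [Nat.cast_zero, zero_mul] at h0 hs
    rw [le_antisymm hs hs₀]
    linarith [sq_nonneg h]
  | succ n ih =>
    rcases le_total s (n * h) with hn | hn
    · exact ih (fun k hk => H k (hk.trans n.le_succ)) hn
    · have e : ((n + 1 : ℕ) * h - n * h : ℝ) = h := by push_cast; ring
      refine add_norm_line_sub_circlePt_le_of_ends hσ ?_ ?_ ⟨hn, hs⟩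
      · rw [e]; exact H n n.le_succ
      · rw [e]; exact H (n + 1) le_rfl

/-- The Taylor polynomial of the cosine of degree `22`. -/
def cosTaylor (x : ℝ) : ℝ := ∑ k ∈ Finset.range 12, (-1) ^ k * x ^ (2 * k) / (2 * k).factorial

/-- The Taylor polynomial of the sine of degree `23`. -/
def sinTaylor (x : ℝ) : ℝ :=
  ∑ k ∈ Finset.range 12, (-1) ^ k * x ^ (2 * k + 1) / (2 * k + 1).factorial

lemma norm_exp_sub_taylor_le {x : ℝ} (hx : |x| ≤ 4) :
    ‖Complex.exp (x * Complex.I) - (cosTaylor x + sinTaylor x * Complex.I)‖ ≤ 1 / 10 ^ 8 := by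
  have hn : ‖(x * Complex.I : ℂ)‖ = |x| := by simp
  have h := Complex.exp_bound' (x := x * Complex.I) (n := 24) (by rw [hn]; norm_num; linarith)
  have e : (∑ m ∈ Finset.range 24, (x * Complex.I) ^ m / (m.factorial : ℂ)) =
      cosTaylor x + sinTaylor x * Complex.I := by
    have hsplit : ∀ (f : ℕ → ℂ) (n : ℕ), ∑ m ∈ Finset.range (2 * n), f m =
        ∑ k ∈ Finset.range n, (f (2 * k) + f (2 * k + 1)) := by
      intro f n
      induction n with
      | zero => simp
      | succ n ih =>
        rw [Nat.mul_succ, Finset.sum_range_succ, Finset.sum_range_succ, ih,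
          Finset.sum_range_succ]
        ring
    rw [hsplit _ 12, Finset.sum_add_distrib]
    unfold cosTaylor sinTaylor
    push_cast
    rw [Finset.sum_mul]
    congr 1 <;> refine Finset.sum_congr rfl fun k _ => ?_
    · rw [mul_pow, pow_mul Complex.I, Complex.I_sq]; ring
    · rw [mul_pow, pow_succ Complex.I, pow_mul Complex.I, Complex.I_sq]; ring
  rw [e, hn] at h
  refine h.trans ?_
  have h4 : |x| ^ 24 ≤ 4 ^ 24 := pow_le_pow_left₀ (abs_nonneg x) hx 24
  calc |x| ^ 24 / (Nat.factorial 24 : ℝ) * 2 ≤ 4 ^ 24 / (Nat.factorial 24 : ℝ) * 2 := by gcongr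
    _ ≤ 1 / 10 ^ 8 := by norm_num [Nat.factorial]

lemma abs_cos_sub_cosTaylor_le {x : ℝ} (hx : |x| ≤ 4) :
    |Real.cos x - cosTaylor x| ≤ 1 / 10 ^ 8 := by
  refine le_trans ?_ (norm_exp_sub_taylor_le hx)
  refine le_trans (le_of_eq ?_) (Complex.abs_re_le_norm _)
  simp [Complex.exp_ofReal_mul_I_re]

lemma abs_sin_sub_sinTaylor_le {x : ℝ} (hx : |x| ≤ 4) :
    |Real.sin x - sinTaylor x| ≤ 1 / 10 ^ 8 := by
  refine le_trans ?_ (norm_exp_sub_taylor_le hx)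
  refine le_trans (le_of_eq ?_) (Complex.abs_im_le_norm _)
  simp [Complex.exp_ofReal_mul_I_im]

lemma norm_sub_circlePt_le {p : Plane} {θ r : ℝ} (hθ : |θ| ≤ 4) (h0 : |p 0| ≤ 2)
    (h1 : |p 1| ≤ 2) (hr : 0 ≤ r)
    (h : p 0 ^ 2 + p 1 ^ 2 + 1 - 2 * (p 0 * cosTaylor θ + p 1 * sinTaylor θ) + 1 / 10 ^ 6 ≤
      r ^ 2) :
    ‖p - circlePt θ‖ ≤ r := by
  refine Plane.norm_le_of_sq_le hr ?_
  simp only [PiLp.sub_apply, circlePt_zero_coord, circlePt_one_coord]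
  have bound : ∀ {a b : ℝ}, |a| ≤ 2 → |b| ≤ 1 / 10 ^ 8 → -(a * b) ≤ 2 * (1 / 10 ^ 8) := by
    intro a b ha hb
    refine (neg_le_abs _).trans ?_
    rw [abs_mul]
    gcongr
  have hc := bound h0 (abs_cos_sub_cosTaylor_le hθ)
  have hs := bound h1 (abs_sin_sub_sinTaylor_le hθ)
  nlinarith [Real.cos_sq_add_sin_sq θ]

lemma LipschitzOnWith.ite_le {E : Type*} [SeminormedAddCommGroup E] {f g : ℝ → E} {a c : ℝ}
    (hf : LipschitzOnWith 1 f (Set.Ici a)) (hg : LipschitzOnWith 1 g (Set.Ici c))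
    (hac : a ≤ c) (h : f c = g c) :
    LipschitzOnWith 1 (fun t => if t ≤ c then f t else g t) (Set.Ici a) := by
  have key : ∀ x ∈ Set.Ici a, ∀ y, x ≤ y →
      dist (if x ≤ c then f x else g x) (if y ≤ c then f y else g y) ≤ dist x y := by
    intro x hx y hxy
    have hy : y ∈ Set.Ici a := le_trans hx hxy
    by_cases hyc : y ≤ c
    · rw [if_pos hyc, if_pos (hxy.trans hyc)]
      simpa using hf.dist_le_mul x hx y hy
    · rw [if_neg hyc]
      push Not at hyc
      by_cases hxc : x ≤ c
      · rw [if_pos hxc]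
        have h1 := hf.dist_le_mul x hx c hac
        have h2 := hg.dist_le_mul c Set.self_mem_Ici y hyc.le
        have h3 := dist_triangle (f x) (f c) (g y)
        rw [h] at h1 h3
        simp only [NNReal.coe_one, one_mul] at h1 h2
        rw [Real.dist_eq, abs_of_nonpos (by linarith)] at h1 h2 ⊢
        linarith
      · rw [if_neg hxc]
        push Not at hxc
        simpa using hg.dist_le_mul x hxc.le y hyc.le
  refine LipschitzOnWith.of_dist_le_mul fun x hx y hy => ?_
  rw [NNReal.coe_one, one_mul]
  rcases le_total x y with hxy | hxy
  · exact key x hx y hxy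
  · rw [dist_comm, dist_comm x]; exact key y hy x hxy

lemma lipschitzOnWith_of_norm_le {E : Type*} [SeminormedAddCommGroup E] {f : ℝ → E} {s : Set ℝ}
    (h : ∀ x y, ‖f x - f y‖ ≤ |x - y|) : LipschitzOnWith 1 f s :=
  LipschitzOnWith.of_dist_le_mul fun x _ y _ => by
    simpa [dist_eq_norm, Real.dist_eq] using h x y

lemma lipschitzOnWith_line (P : Plane) (c : ℝ) {v : Plane} (hv : ‖v‖ ≤ 1) (s : Set ℝ) :
    LipschitzOnWith 1 (fun t : ℝ => P + (t - c) • v) s := by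
  refine lipschitzOnWith_of_norm_le fun x y => ?_
  rw [add_sub_add_left_eq_sub, ← sub_smul, norm_smul, Real.norm_eq_abs, sub_sub_sub_cancel_right]
  exact mul_le_of_le_one_right (abs_nonneg _) hv

lemma lipschitzOnWith_arc (β c : ℝ) {σ : ℝ} (hσ : |σ| = 1) (s : Set ℝ) :
    LipschitzOnWith 1 (fun t : ℝ => circlePt (β + σ * (t - c))) s := by
  refine lipschitzOnWith_of_norm_le fun x y => (norm_circlePt_sub_le _ _).trans ?_
  rw [add_sub_add_left_eq_sub, ← mul_sub, abs_mul, hσ, one_mul, sub_sub_sub_cancel_right]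

/-- The trajectory that goes straight to the circle point at angle `β`, then along the circle with
angular velocity `σ` until time `T`, and stops. -/
def servant (β σ T t : ℝ) : Plane :=
  if t ≤ 1 then t • circlePt β
  else if t ≤ T then circlePt (β + σ * (t - 1)) else circlePt (β + σ * (T - 1))

lemma isTraj_servant (β : ℝ) {σ T : ℝ} (hσ : |σ| = 1) (hT : 1 ≤ T) : IsTraj (servant β σ T) := by
  refine ⟨?_, by simp [servant]⟩
  refine LipschitzOnWith.ite_le ?_
    (LipschitzOnWith.ite_le (lipschitzOnWith_arc β 1 hσ _)
      (lipschitzOnWith_of_norm_le fun x y => by simp) hT rfl) zero_le_one ?_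
  · simpa using lipschitzOnWith_line 0 0 (norm_circlePt β).le (Set.Ici 0)
  · simp [hT]

lemma servant_of_mem {β σ T t : ℝ} (ht : t ∈ Set.Icc 1 T) :
    servant β σ T t = circlePt (β + σ * (t - 1)) := by
  unfold servant
  split_ifs with h1 h2
  · rw [le_antisymm h1 ht.1]; simp
  · rfl
  · exact absurd ht.2 h2

lemma servant_of_lt_one {β σ T t : ℝ} (h0 : 0 ≤ t) (ht : t < 1) : ‖servant β σ T t‖ < 1 := by
  rw [servant, if_pos ht.le, norm_smul, norm_circlePt, Real.norm_eq_abs, abs_of_nonneg h0]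
  simpa using ht

lemma servant_of_le {β σ T t : ℝ} (hT : 1 ≤ T) (ht : T ≤ t) :
    servant β σ T t = servant β σ T T := by
  rw [servant_of_mem ⟨hT, le_rfl⟩]
  rcases eq_or_lt_of_le ht with rfl | h
  · rw [servant_of_mem ⟨hT, le_rfl⟩]
  · rw [servant, if_neg (by linarith), if_neg (by linarith)]

lemma evacuates_of_bound {n : ℕ} {Q : ℝ → Plane} {S : Fin n → ℝ → Plane} {B : ℝ}
    (hQ : IsTraj Q) (hS : ∀ i, IsTraj (S i))
    (hcov : ∀ p : Plane, ‖p‖ = 1 → ∃ t, 0 ≤ t ∧ t ≤ B ∧ (Q t = p ∨ ∃ i, S i t = p))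
    (hB : ∀ i t, 0 ≤ t → ‖S i t‖ = 1 →
      (t + ‖Q t - S i t‖ ≤ B ∨ ∃ s, 0 ≤ s ∧ s < t ∧ S i s = S i t)) :
    Evacuates Q S B := by
  intro p hp
  obtain ⟨t, ht0, htB, ht⟩ := hcov p hp
  refine ⟨⟨t, ht0, ht⟩, ?_⟩
  set V : Set ℝ := {t : ℝ | 0 ≤ t ∧ (Q t = p ∨ ∃ i, S i t = p)} with hV
  have hbdd : BddBelow V := ⟨0, fun x hx => hx.1⟩
  have hclosed : IsClosed V := by
    have e : V = (Set.Ici 0 ∩ Q ⁻¹' {p}) ∪ ⋃ i, (Set.Ici 0 ∩ S i ⁻¹' {p}) := by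
      ext x
      simp [hV, and_or_left]
    rw [e]
    refine IsClosed.union
      (hQ.1.continuousOn.preimage_isClosed_of_isClosed isClosed_Ici isClosed_singleton)
      (isClosed_iUnion_of_finite fun i =>
        (hS i).1.continuousOn.preimage_isClosed_of_isClosed isClosed_Ici isClosed_singleton)
  have hmem : sInf V ∈ V := hclosed.csInf_mem ⟨t, ht0, ht⟩ hbdd
  have hle : sInf V ≤ B := (csInf_le hbdd ⟨ht0, ht⟩).trans htB
  change sInf V + ‖Q (sInf V) - p‖ ≤ B
  obtain ⟨h0, h | ⟨i, h⟩⟩ := hmem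
  · simpa [h] using hle
  · rcases hB i _ h0 (by rw [h, hp]) with hb | ⟨s, hs0, hs, he⟩
    · rwa [h] at hb
    · exact absurd (csInf_le hbdd ⟨hs0, Or.inr ⟨i, he.trans h⟩⟩) (not_le.2 hs)

/-- The queen's trajectory: straight to the circle, along an arc of length `0.2636`, then along
three segments towards the point where two of the servants finish, where she waits. -/
def queen (t : ℝ) : Plane :=
  if t ≤ 1 then t • circlePt 0.2636
  else if t ≤ 1.2636 then circlePt (0.2636 + (-1) * (t - 1))
  else if t ≤ 2.25 then !₂[1, 0] + (t - 1.2636) • !₂[-0.9807, -0.1954]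
  else if t ≤ 2.635 then !₂[0.03263752, -0.19274256] + (t - 2.25) • !₂[-0.9328, -0.3602]
  else if t ≤ 3.17 then !₂[-0.32649048, -0.33141956] + (t - 2.635) • !₂[-0.7313, -0.6819]
  else !₂[-0.71773598, -0.69623606] + (t - 3.17) • !₂[0, 0]

lemma isTraj_queen : IsTraj queen := by
  have hv : ∀ x y : ℝ, x ^ 2 + y ^ 2 ≤ 1 → ‖(!₂[x, y] : Plane)‖ ≤ 1 := fun x y h =>
    Plane.norm_le_of_sq_le zero_le_one (by simpa using h)
  refine ⟨?_, by simp [queen]⟩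
  refine LipschitzOnWith.ite_le ?_ (LipschitzOnWith.ite_le (lipschitzOnWith_arc _ 1 (by simp) _)
    (LipschitzOnWith.ite_le (lipschitzOnWith_line _ _ (hv _ _ (by norm_num)) _)
      (LipschitzOnWith.ite_le (lipschitzOnWith_line _ _ (hv _ _ (by norm_num)) _)
        (LipschitzOnWith.ite_le (lipschitzOnWith_line _ _ (hv _ _ (by norm_num)) _)
          (lipschitzOnWith_line _ _ (hv _ _ (by norm_num)) _)
          (by norm_num) ?_) (by norm_num) ?_) (by norm_num) ?_) (by norm_num) ?_)
    zero_le_one ?_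
  · simpa using lipschitzOnWith_line 0 0 (norm_circlePt 0.2636).le (Set.Ici 0)
  · ext i; fin_cases i <;> norm_num
  · norm_num
    ext i; fin_cases i <;> norm_num
  · norm_num
    ext i; fin_cases i <;> norm_num
  · norm_num
    ext i; fin_cases i
    · simp [circlePt_zero_coord]
    · simp [circlePt_one_coord]
  · norm_num

lemma queen_of_mem_arc {t : ℝ} (ht : t ∈ Set.Icc 1 1.2636) :
    queen t = circlePt (0.2636 + (-1) * (t - 1)) := by
  unfold queen
  split_ifs with h1 h2
  · rw [le_antisymm h1 ht.1]; simp
  · rfl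
  all_goals exact absurd ht.2 h2

/-- Reduces the evacuation bound while the queen moves along a segment to a time grid. -/
lemma queen_servant_bound_of_grid {P v : Plane} {β σ T B a h t : ℝ} (N : ℕ) (hσ : σ ^ 2 = 1)
    (hQ : queen t = P + (t - a) • v) (ha : 1 ≤ a) (ht₀ : a ≤ t) (ht : t ≤ a + N * h) (htT : t ≤ T)
    (H : ∀ k : ℕ, k ≤ N →
      a + k * h + ‖P + (k * h) • v - circlePt (β + σ * (a - 1) + σ * (k * h))‖ ≤ B - h ^ 2 / 8) :
    t + ‖queen t - servant β σ T t‖ ≤ B := by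
  rw [servant_of_mem ⟨ha.trans ht₀, htT⟩, hQ]
  have := add_norm_line_sub_circlePt_le_of_grid hσ N H (sub_nonneg.2 ht₀) (by linarith)
  convert this using 3
  · ring
  · congr 2; ring

lemma grid_point_bound {P v : Plane} {a s B h θ : ℝ} (hθ : θ ^ 2 ≤ 4 ^ 2)
    (h0 : (P 0 + s * v 0) ^ 2 ≤ 2 ^ 2) (h1 : (P 1 + s * v 1) ^ 2 ≤ 2 ^ 2)
    (hr : 0 ≤ B - h ^ 2 / 8 - (a + s))
    (hle : (P 0 + s * v 0) ^ 2 + (P 1 + s * v 1) ^ 2 + 1 -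
      2 * ((P 0 + s * v 0) * cosTaylor θ + (P 1 + s * v 1) * sinTaylor θ) + 1 / 10 ^ 6 ≤
      (B - h ^ 2 / 8 - (a + s)) ^ 2) :
    a + s + ‖P + s • v - circlePt θ‖ ≤ B - h ^ 2 / 8 := by
  have := norm_sub_circlePt_le (p := P + s • v) (abs_le_of_sq_le_sq hθ (by norm_num))
    (abs_le_of_sq_le_sq h0 zero_le_two) (abs_le_of_sq_le_sq h1 zero_le_two) hr hle
  linarith

lemma queen_servant_bound_of_mem_arc {β σ T t : ℝ} (ht : t ∈ Set.Icc 1 1.2636) (htT : t ≤ T) :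
    t + ‖queen t - servant β σ T t‖ ≤ 3.37882 := by
  rw [queen_of_mem_arc ht, servant_of_mem ⟨ht.1, htT⟩]
  have h := norm_sub_le (circlePt (0.2636 + (-1) * (t - 1))) (circlePt (β + σ * (t - 1)))
  rw [norm_circlePt, norm_circlePt] at h
  have h2 := ht.2
  have h3 : (1.2636 : ℝ) + 2 ≤ 3.37882 := by norm_num
  linarith

lemma queen_of_mem_Ioc_first {t : ℝ} (h₁ : 1.2636 < t) (h₂ : t ≤ 2.25) :
    queen t = !₂[1, 0] + (t - 1.2636) • !₂[-0.9807, -0.1954] := by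
  norm_num at h₁ h₂
  rw [queen, if_neg (by linarith), if_neg (by norm_num; linarith), if_pos (by norm_num; linarith)]

lemma queen_of_mem_Ioc_second {t : ℝ} (h₁ : 2.25 < t) (h₂ : t ≤ 2.635) :
    queen t = !₂[0.03263752, -0.19274256] + (t - 2.25) • !₂[-0.9328, -0.3602] := by
  norm_num at h₁ h₂
  rw [queen, if_neg (by linarith), if_neg (by norm_num; linarith), if_neg (by norm_num; linarith),
    if_pos (by norm_num; linarith)]

lemma queen_of_mem_Ioc_third {t : ℝ} (h₁ : 2.635 < t) (h₂ : t ≤ 3.17) :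
    queen t = !₂[-0.32649048, -0.33141956] + (t - 2.635) • !₂[-0.7313, -0.6819] := by
  norm_num at h₁ h₂
  rw [queen, if_neg (by linarith), if_neg (by norm_num; linarith), if_neg (by norm_num; linarith),
    if_neg (by norm_num; linarith), if_pos (by norm_num; linarith)]

lemma queen_of_gt {t : ℝ} (h : 3.17 < t) :
    queen t = !₂[-0.71773598, -0.69623606] + (t - 3.17) • !₂[0, 0] := by
  norm_num at h
  rw [queen, if_neg (by linarith), if_neg (by norm_num; linarith), if_neg (by norm_num; linarith),
    if_neg (by norm_num; linarith), if_neg (by norm_num; linarith)]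

lemma queen_first_servant_bound {t : ℝ} (ht₁ : 1 ≤ t) (htT : t ≤ 3.353) :
    t + ‖queen t - servant 1.5585 1 3.353 t‖ ≤ 3.37882 := by
  rcases le_or_gt t 1.2636 with h1 | h1
  · exact queen_servant_bound_of_mem_arc ⟨ht₁, h1⟩ htT
  rcases le_or_gt t 2.25 with h2 | h2
  · refine queen_servant_bound_of_grid (a := 1.2636) (h := 411 / 1250) 3 (by norm_num)
      (queen_of_mem_Ioc_first h1 h2) (by norm_num)
      (by linarith) (by norm_num; linarith) htT fun k hk => ?_
    interval_cases k <;> refine grid_point_bound ?_ ?_ ?_ ?_ ?_ <;>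
      norm_num [cosTaylor, sinTaylor, Finset.sum_range_succ, Nat.factorial]
  rcases le_or_gt t 2.635 with h3 | h3
  · refine queen_servant_bound_of_grid (a := 2.25) (h := 77 / 800) 4 (by norm_num)
      (queen_of_mem_Ioc_second h2 h3) (by norm_num)
      (by linarith) (by norm_num; linarith) htT fun k hk => ?_
    interval_cases k <;> refine grid_point_bound ?_ ?_ ?_ ?_ ?_ <;>
      norm_num [cosTaylor, sinTaylor, Finset.sum_range_succ, Nat.factorial]
  rcases le_or_gt t 3.17 with h4 | h4
  · refine queen_servant_bound_of_grid (a := 2.635) (h := 107 / 800) 4 (by norm_num)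
      (queen_of_mem_Ioc_third h3 h4) (by norm_num)
      (by linarith) (by norm_num; linarith) htT fun k hk => ?_
    interval_cases k <;> refine grid_point_bound ?_ ?_ ?_ ?_ ?_ <;>
      norm_num [cosTaylor, sinTaylor, Finset.sum_range_succ, Nat.factorial]
  refine queen_servant_bound_of_grid (a := 3.17) (h := 183 / 1000) 1 (by norm_num)
    (queen_of_gt h4) (by norm_num)
    (by linarith) (by norm_num; linarith) htT fun k hk => ?_
  interval_cases k <;> refine grid_point_bound ?_ ?_ ?_ ?_ ?_ <;>
    norm_num [cosTaylor, sinTaylor, Finset.sum_range_succ, Nat.factorial]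

lemma queen_second_servant_bound {t : ℝ} (ht₁ : 1 ≤ t) (htT : t ≤ 3.3717) :
    t + ‖queen t - servant 0 (-1) 3.3717 t‖ ≤ 3.37882 := by
  rcases le_or_gt t 1.2636 with h1 | h1
  · exact queen_servant_bound_of_mem_arc ⟨ht₁, h1⟩ htT
  rcases le_or_gt t 2.25 with h2 | h2
  · refine queen_servant_bound_of_grid (a := 1.2636) (h := 1233 / 1250) 1 (by norm_num)
      (queen_of_mem_Ioc_first h1 h2) (by norm_num)
      (by linarith) (by norm_num; linarith) htT fun k hk => ?_
    interval_cases k <;> refine grid_point_bound ?_ ?_ ?_ ?_ ?_ <;>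
      norm_num [cosTaylor, sinTaylor, Finset.sum_range_succ, Nat.factorial]
  rcases le_or_gt t 2.635 with h3 | h3
  · refine queen_servant_bound_of_grid (a := 2.25) (h := 77 / 600) 3 (by norm_num)
      (queen_of_mem_Ioc_second h2 h3) (by norm_num)
      (by linarith) (by norm_num; linarith) htT fun k hk => ?_
    interval_cases k <;> refine grid_point_bound ?_ ?_ ?_ ?_ ?_ <;>
      norm_num [cosTaylor, sinTaylor, Finset.sum_range_succ, Nat.factorial]
  rcases le_or_gt t 3.17 with h4 | h4
  · refine queen_servant_bound_of_grid (a := 2.635) (h := 107 / 1000) 5 (by norm_num)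
      (queen_of_mem_Ioc_third h3 h4) (by norm_num)
      (by linarith) (by norm_num; linarith) htT fun k hk => ?_
    interval_cases k <;> refine grid_point_bound ?_ ?_ ?_ ?_ ?_ <;>
      norm_num [cosTaylor, sinTaylor, Finset.sum_range_succ, Nat.factorial]
  refine queen_servant_bound_of_grid (a := 3.17) (h := 2017 / 20000) 2 (by norm_num)
    (queen_of_gt h4) (by norm_num)
    (by linarith) (by norm_num; linarith) htT fun k hk => ?_
  interval_cases k <;> refine grid_point_bound ?_ ?_ ?_ ?_ ?_ <;>
    norm_num [cosTaylor, sinTaylor, Finset.sum_range_succ, Nat.factorial]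

lemma queen_third_servant_bound {t : ℝ} (ht₁ : 1 ≤ t) (htT : t ≤ 2.2949) :
    t + ‖queen t - servant 1.5585 (-1) 2.2949 t‖ ≤ 3.37882 := by
  rcases le_or_gt t 1.2636 with h1 | h1
  · exact queen_servant_bound_of_mem_arc ⟨ht₁, h1⟩ htT
  rcases le_or_gt t 2.25 with h2 | h2
  · refine queen_servant_bound_of_grid (a := 1.2636) (h := 1233 / 2500) 2 (by norm_num)
      (queen_of_mem_Ioc_first h1 h2) (by norm_num)
      (by linarith) (by norm_num; linarith) htT fun k hk => ?_
    interval_cases k <;> refine grid_point_bound ?_ ?_ ?_ ?_ ?_ <;>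
      norm_num [cosTaylor, sinTaylor, Finset.sum_range_succ, Nat.factorial]
  refine queen_servant_bound_of_grid (a := 2.25) (h := 449 / 10000) 1 (by norm_num)
    (queen_of_mem_Ioc_second h2 (htT.trans (by norm_num))) (by norm_num)
    (by linarith) (by norm_num; linarith) htT fun k hk => ?_
  interval_cases k <;> refine grid_point_bound ?_ ?_ ?_ ?_ ?_ <;>
    norm_num [cosTaylor, sinTaylor, Finset.sum_range_succ, Nat.factorial]

lemma servant_bound_or_earlier {Q : ℝ → Plane} {β σ T B t : ℝ} (hT : 1 ≤ T)
    (H : ∀ {t : ℝ}, 1 ≤ t → t ≤ T → t + ‖Q t - servant β σ T t‖ ≤ B) (h0 : 0 ≤ t)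
    (hn : ‖servant β σ T t‖ = 1) :
    t + ‖Q t - servant β σ T t‖ ≤ B ∨ ∃ s, 0 ≤ s ∧ s < t ∧ servant β σ T s = servant β σ T t := by
  rcases lt_or_ge t 1 with h1 | h1
  · exact absurd hn (servant_of_lt_one h0 h1).ne
  · rcases le_or_gt t T with h2 | h2
    · exact Or.inl (H h1 h2)
    · exact Or.inr ⟨T, by linarith, h2, (servant_of_le hT h2.le).symm⟩

lemma exists_visit {p : Plane} (hp : ‖p‖ = 1) : ∃ t, 0 ≤ t ∧ t ≤ 3.37882 ∧
    (queen t = p ∨ servant 1.5585 1 3.353 t = p ∨ servant 0 (-1) 3.3717 t = p ∨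
      servant 1.5585 (-1) 2.2949 t = p) := by
  obtain ⟨θ, ⟨hθ₀, hθ⟩, rfl⟩ := exists_circlePt_eq hp
  have hπ := Real.pi_lt_d4
  norm_num at hπ
  rcases le_total θ 0.2636 with h1 | h1
  · norm_num at h1
    refine ⟨1.2636 - θ, by norm_num; linarith, by norm_num; linarith, Or.inl ?_⟩
    rw [queen_of_mem_arc ⟨by norm_num; linarith, by norm_num; linarith⟩]
    congr 1; ring
  rcases le_total θ 1.5585 with h2 | h2
  · norm_num at h1 h2
    refine ⟨2.5585 - θ, by norm_num; linarith, by norm_num; linarith, Or.inr (Or.inr (Or.inr ?_))⟩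
    rw [servant_of_mem ⟨by norm_num; linarith, by norm_num; linarith⟩]
    congr 1; ring
  rcases le_total θ 3.9115 with h3 | h3
  · norm_num at h2 h3
    refine ⟨θ - 0.5585, by norm_num; linarith, by norm_num; linarith, Or.inr (Or.inl ?_)⟩
    rw [servant_of_mem ⟨by norm_num; linarith, by norm_num; linarith⟩]
    congr 1; ring
  · norm_num at h3
    refine ⟨1 + 2 * π - θ, by linarith, by norm_num; linarith, Or.inr (Or.inr (Or.inl ?_))⟩
    rw [servant_of_mem ⟨by linarith, by norm_num; linarith⟩]
    have e : (0 : ℝ) + (-1) * (1 + 2 * π - θ - 1) = θ - 2 * π := by ring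
    rw [e, circlePt, Real.cos_sub_two_pi, Real.sin_sub_two_pi, ← circlePt]

/-- with three servants the queen can be evacuated in time `3.37882`. -/
theorem priority_evacuation_three_servants_upper_bound :
    ∃ Q S₁ S₂ S₃ : ℝ → Plane, IsTraj Q ∧ IsTraj S₁ ∧ IsTraj S₂ ∧ IsTraj S₃ ∧
      Evacuates Q ![S₁, S₂, S₃] (3.37882 : ℝ) := by
  have hs : ∀ i, IsTraj ((![servant 1.5585 1 3.353, servant 0 (-1) 3.3717,
      servant 1.5585 (-1) 2.2949] : Fin 3 → ℝ → Plane) i) := by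
    intro i
    fin_cases i <;> exact isTraj_servant _ (by simp) (by norm_num)
  refine ⟨queen, _, _, _, isTraj_queen, hs 0, hs 1, hs 2,
    evacuates_of_bound isTraj_queen hs (fun p hp => ?_) fun i t h0 hn => ?_⟩
  · obtain ⟨t, h0, hB, h | h | h | h⟩ := exists_visit hp
    · exact ⟨t, h0, hB, Or.inl h⟩
    · exact ⟨t, h0, hB, Or.inr ⟨0, h⟩⟩
    · exact ⟨t, h0, hB, Or.inr ⟨1, h⟩⟩
    · exact ⟨t, h0, hB, Or.inr ⟨2, h⟩⟩
  · fin_cases i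
    · exact servant_bound_or_earlier (by norm_num) queen_first_servant_bound h0 hn
    · exact servant_bound_or_earlier (by norm_num) queen_second_servant_bound h0 hn
    · exact servant_bound_or_earlier (by norm_num) queen_third_servant_bound h0 hn
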